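/- Every monotonically normal space of cardinality less than ℵ_ω is maximally resolvable, provided it is crowded. -/

import Mathlib

open Cardinal

/-- A space is `κ`-resolvable if it contains `κ` pairwise disjoint dense subsets. -/
def Resolvable (X : Type*) [TopologicalSpace X] (κ : Cardinal) : Prop :=
  ∃ D : Set (Set X), #D = κ ∧ (∀ d ∈ D, Dense d) ∧ D.PairwiseDisjoint id

/-- `Δ(X)`: the minimum cardinality of a nonempty open subset of `X`. -/
noncomputable def Delta (X : Type*) [TopologicalSpace X] : Cardinal :=
  sInf {c : Cardinal | ∃ U : Set X, IsOpen U ∧ U.Nonempty ∧ #U = c}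

/-- `X` is maximally resolvable if it is `Δ(X)`-resolvable. -/
def MaximallyResolvable (X : Type*) [TopologicalSpace X] : Prop :=
  Resolvable X (Delta X)

/-- A (T₁) space is monotonically normal if there is an operator H assigning to each pair
(x, U) with x ∈ U open an open set H x U with x ∈ H x U ⊆ U, such that
H x U ∩ H y V ≠ ∅ implies x ∈ V or y ∈ U. -/
def MonotonicallyNormal (X : Type*) [TopologicalSpace X] : Prop :=
  ∃ H : X → Set X → Set X,
    (∀ x U, IsOpen U → x ∈ U → IsOpen (H x U) ∧ x ∈ H x U ∧ H x U ⊆ U) ∧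
    (∀ x U y V, IsOpen U → x ∈ U → IsOpen V → y ∈ V →
      (H x U ∩ H y V).Nonempty → x ∈ V ∨ y ∈ U)

/-- A space is crowded if it has no isolated points. -/
def Crowded (X : Type*) [TopologicalSpace X] : Prop :=
  ∀ x : X, Filter.NeBot (nhdsWithin x {x}ᶜ)

universe u

open Set Filter Topology Order

theorem exists_maximal_pairwise {α : Type*} (P : α → Prop) (r : α → α → Prop) :
    ∃ s : Set α, (∀ a ∈ s, P a) ∧ s.Pairwise r ∧
      ∀ a, P a → (∀ b ∈ s, r a b ∧ r b a) → a ∈ s := by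
  obtain ⟨s, hs⟩ := zorn_subset {s : Set α | (∀ a ∈ s, P a) ∧ s.Pairwise r} (by
    intro c hc hchain
    refine ⟨⋃₀ c, ⟨?_, ?_⟩, fun s hs => subset_sUnion_of_mem hs⟩
    · rintro a ⟨t, ht, hat⟩
      exact (hc ht).1 a hat
    · exact (pairwise_sUnion hchain.directedOn).2 fun t ht => (hc ht).2)
  refine ⟨s, hs.prop.1, hs.prop.2, fun a ha hr => ?_⟩
  have hins : insert a s ∈ {s : Set α | (∀ a ∈ s, P a) ∧ s.Pairwise r} :=
    ⟨by rintro b (rfl | hb); exacts [ha, hs.prop.1 b hb],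
      hs.prop.2.insert fun b hb _ => hr b hb⟩
  exact hs.le_of_ge hins (subset_insert a s) (mem_insert a s)

theorem Cardinal.mk_Iio_toType_lt {κ : Cardinal.{u}} (a : κ.ord.ToType) : #(Iio a) < κ := by
  simpa using mk_Iio_lt a

theorem Cardinal.IsRegular.mk_Iic_toType_lt {κ : Cardinal.{u}} (hκ : κ.IsRegular)
    (a : κ.ord.ToType) : #(Iic a) < κ := by
  simpa using mk_Iic_lt a (by simp) (by simpa using hκ.aleph0_le)

theorem Cardinal.IsRegular.nonempty_toType {κ : Cardinal.{u}} (hκ : κ.IsRegular) :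
    Nonempty κ.ord.ToType := by
  rw [← mk_ne_zero_iff, mk_ord_toType]
  exact hκ.ne_zero

theorem Cardinal.IsRegular.exists_forall_lt {κ : Cardinal.{u}} (hκ : κ.IsRegular)
    {S : Set κ.ord.ToType} (hS : #S < κ) : ∃ b, ∀ a ∈ S, a < b := by
  rw [← not_isCofinal_iff]
  intro h
  have := Order.cof_le h
  rw [Ordinal.cof_toType, hκ.cof_ord] at this
  exact this.not_gt hS

/-- An ultrafilter is `κ`-unbounded if some map to the initial ordinal of `κ` has no bound on any
set of the ultrafilter. -/
def Ultrafilter.UnboundedAt {X : Type u} (v : Ultrafilter X) (κ : Cardinal.{u}) : Prop :=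
  ∃ f : X → κ.ord.ToType, ∀ a, ∀ᶠ x in v, a < f x

theorem Ultrafilter.UnboundedAt.of_succ {X : Type u} {v : Ultrafilter X} {κ : Cardinal.{u}}
    (hκ : κ.IsRegular) (h : v.UnboundedAt (Order.succ κ)) : v.UnboundedAt κ := by
  obtain ⟨f, hf⟩ := h
  by_contra hcon
  have hbdd : ∀ g : X → κ.ord.ToType, ∃ a, ∀ᶠ x in v, g x ≤ a := by
    intro g
    by_contra! hg
    refine hcon ⟨g, fun a => ?_⟩
    simpa using hg a
  have hemb : ∀ a : (Order.succ κ).ord.ToType,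
      ∃ e : (Order.succ κ).ord.ToType → κ.ord.ToType, InjOn e (Iio a) := by
    intro a
    have hcard : #(Iio a) ≤ #κ.ord.ToType := by
      rw [mk_ord_toType, ← Order.lt_succ_iff]
      exact mk_Iio_toType_lt a
    have := hκ.nonempty_toType
    obtain ⟨j⟩ := hcard
    classical
    refine ⟨fun b => if hb : b ∈ Iio a then j ⟨b, hb⟩ else Classical.arbitrary _, ?_⟩
    intro b hb c hc hbc
    simp only [hb, hc, dif_pos] at hbc
    simpa using j.injective hbc
  choose e he using hemb
  choose ξ hξ using fun b => hbdd fun x => e (f x) b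
  have hreg := isRegular_succ hκ.aleph0_le
  obtain ⟨c, hc⟩ := infinite_pigeonhole ξ (by simpa using hκ.aleph0_le.trans (Order.le_succ κ))
    (by simp only [mk_ord_toType, hreg.cof_ord]; exact Order.lt_succ κ)
  have hle : #κ.ord.ToType ≤ #(ξ ⁻¹' {c}) := by
    rw [hc, mk_ord_toType, mk_ord_toType]; exact Order.le_succ κ
  obtain ⟨j⟩ := hle
  have hmem : ∀ i, ∀ᶠ x in v, (j i : (Order.succ κ).ord.ToType) < f x ∧ e (f x) (j i) ≤ c := by
    intro i
    filter_upwards [hf (j i), hξ (j i)] with x hx hx'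
    have hji : ξ (j i) = c := (j i).2
    exact ⟨hx, hx'.trans hji.le⟩
  have hg : ∀ x, ∃ b, ∀ i, (j i : (Order.succ κ).ord.ToType) < f x ∧ e (f x) (j i) ≤ c →
      i < b := by
    intro x
    refine hκ.exists_forall_lt (S := {i | (j i : (Order.succ κ).ord.ToType) < f x ∧
      e (f x) (j i) ≤ c}) ?_
    refine lt_of_le_of_lt (mk_le_of_injective (f := fun i => (⟨e (f x) (j i.1), i.2.2⟩ : Iic c)) ?_)
      (hκ.mk_Iic_toType_lt c)
    intro i i' hii
    have h1 := he (f x) i.2.1 i'.2.1 (Subtype.ext_iff.1 hii)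
    exact Subtype.ext (j.injective (Subtype.ext h1))
  choose g hg using hg
  obtain ⟨η, hη⟩ := hbdd g
  obtain ⟨x, hx, hx'⟩ := (hη.and (hmem η)).exists
  exact (hg x η hx').not_ge hx

theorem Cardinal.isRegular_aleph_natCast (n : ℕ) : (ℵ_ (n : Ordinal.{u})).IsRegular := by
  cases n with
  | zero => simpa using isRegular_aleph0
  | succ k => simpa using isRegular_aleph_add_one (k : Ordinal.{u})

theorem Ultrafilter.UnboundedAt.aleph {X : Type u} {v : Ultrafilter X} {n : ℕ}
    (h : v.UnboundedAt (ℵ_ n)) {m : ℕ} (hm : m ≤ n) : v.UnboundedAt (ℵ_ m) := by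
  induction n with
  | zero => obtain rfl := Nat.le_zero.1 hm; exact h
  | succ n ih =>
    rcases hm.lt_or_eq with hlt | rfl
    · refine ih (.of_succ (isRegular_aleph_natCast n) ?_) (Nat.lt_succ_iff.1 hlt)
      rw [succ_aleph]; simpa using h
    · exact h

theorem Ultrafilter.unboundedAt_of_mk_le {X : Type u} {v : Ultrafilter X} {κ : Cardinal.{u}}
    (hκ : κ.IsRegular) {V : Set X} (hV : V ∈ v) (hVκ : #V ≤ κ)
    (hv : ∀ B : Set X, #B < κ → Bᶜ ∈ v) : v.UnboundedAt κ := by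
  rw [← mk_ord_toType κ] at hVκ
  obtain ⟨j⟩ := hVκ
  have := hκ.nonempty_toType
  classical
  refine ⟨fun x => if hx : x ∈ V then j ⟨x, hx⟩ else Classical.arbitrary _, fun a => ?_⟩
  filter_upwards [hV, hv ((↑) '' (j ⁻¹' Iic a)) (mk_image_le.trans_lt
    ((mk_preimage_of_injective _ _ j.injective).trans_lt (hκ.mk_Iic_toType_lt a)))] with x hx hxa
  simp only [hx, dif_pos]
  by_contra hcon
  exact hxa ⟨⟨x, hx⟩, not_lt.1 hcon, rfl⟩

/-- A tree of points of `X`: each node has a point, a hull containing the points of all its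
descendants, a set of successor points together with a child node for each of them, and an
ultrafilter concentrated on the set of successor points. -/
structure UltraTree (X : Type u) where
  /-- The nodes. -/
  Node : Type u
  /-- The point of a node. -/
  pt : Node → X
  /-- The hull of a node. -/
  hull : Node → Set X
  /-- The successor points of a node. -/
  succs : Node → Set X
  /-- The child of a node at a given successor point. -/
  child : Node → X → Node
  /-- The ultrafilter of a node. -/
  ultra : Node → Ultrafilter X
  /-- The root. -/
  root : Node
  pt_mem_hull : ∀ p, pt p ∈ hull p
  pt_child : ∀ p, ∀ y ∈ succs p, pt (child p y) = y
  hull_child_subset : ∀ p, ∀ y ∈ succs p, hull (child p y) ⊆ hull p \ {pt p}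
  pairwiseDisjoint_hull : ∀ p, (succs p).PairwiseDisjoint fun y => hull (child p y)
  succs_mem : ∀ p, succs p ∈ ultra p

namespace UltraTree

variable {X : Type u} (T : UltraTree X)

/-- The set of nodes at a given level. -/
def level : ℕ → Set T.Node
  | 0 => {T.root}
  | k + 1 => {q | ∃ p ∈ level k, ∃ y ∈ T.succs p, q = T.child p y}

variable {T}

theorem child_mem_level {k : ℕ} {p : T.Node} (hp : p ∈ T.level k) {y : X} (hy : y ∈ T.succs p) :
    T.child p y ∈ T.level (k + 1) :=
  ⟨p, hp, y, hy, rfl⟩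

theorem eq_of_mem_hull {k : ℕ} {p q : T.Node} (hp : p ∈ T.level k) (hq : q ∈ T.level k) {x : X}
    (hxp : x ∈ T.hull p) (hxq : x ∈ T.hull q) : p = q := by
  induction k generalizing p q with
  | zero => exact (mem_singleton_iff.1 hp).trans (mem_singleton_iff.1 hq).symm
  | succ k ih =>
    obtain ⟨p', hp', y, hy, rfl⟩ := hp
    obtain ⟨q', hq', z, hz, rfl⟩ := hq
    obtain rfl := ih hp' hq' (T.hull_child_subset p' y hy hxp).1
      (T.hull_child_subset q' z hz hxq).1
    rw [(T.pairwiseDisjoint_hull p').elim_set hy hz x hxp hxq]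

theorem exists_ancestor {k j : ℕ} (hkj : k < j) {q : T.Node} (hq : q ∈ T.level j) :
    ∃ p ∈ T.level k, T.hull q ⊆ T.hull p \ {T.pt p} := by
  induction j generalizing q with
  | zero => omega
  | succ j ih =>
    obtain ⟨p', hp', y, hy, rfl⟩ := hq
    have hsub := T.hull_child_subset p' y hy
    rcases (Nat.lt_succ_iff.1 hkj).lt_or_eq with hlt | rfl
    · obtain ⟨p, hp, hpp⟩ := ih hlt hp'
      exact ⟨p, hp, hsub.trans (sdiff_subset.trans hpp)⟩
    · exact ⟨p', hp', hsub⟩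

theorem level_unique {k j : ℕ} {p q : T.Node} (hp : p ∈ T.level k) (hq : q ∈ T.level j)
    (hpq : T.pt p = T.pt q) : k = j := by
  wlog hkj : k < j generalizing k j p q
  · rcases (not_lt.1 hkj).lt_or_eq with h | h
    · exact (this hq hp hpq.symm h).symm
    · exact h.symm
  obtain ⟨a, ha, hqa⟩ := exists_ancestor hkj hq
  have hqa' := hqa (T.pt_mem_hull q)
  obtain rfl := eq_of_mem_hull hp ha (hpq ▸ T.pt_mem_hull p) hqa'.1
  exact absurd hpq.symm hqa'.2

variable (T) in
open Classical in
/-- The node at level `k` whose hull contains `x`, or the root if there is none. -/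
noncomputable def ancestor (k : ℕ) (x : X) : T.Node :=
  if h : ∃ p ∈ T.level k, x ∈ T.hull p then h.choose else T.root

theorem ancestor_eq {k : ℕ} {p : T.Node} (hp : p ∈ T.level k) {x : X} (hx : x ∈ T.hull p) :
    T.ancestor k x = p := by
  have h : ∃ p ∈ T.level k, x ∈ T.hull p := ⟨p, hp, hx⟩
  rw [ancestor, dif_pos h]
  exact eq_of_mem_hull h.choose_spec.1 hp h.choose_spec.2 hx

variable (T) in
open Classical in
/-- The level of the node whose point is `x`, or `0` if there is none. -/
noncomputable def depth (x : X) : ℕ :=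
  if h : ∃ k, ∃ p ∈ T.level k, T.pt p = x then h.choose else 0

theorem depth_pt {k : ℕ} {p : T.Node} (hp : p ∈ T.level k) : T.depth (T.pt p) = k := by
  have h : ∃ k, ∃ q ∈ T.level k, T.pt q = T.pt p := ⟨k, p, hp, rfl⟩
  rw [depth, dif_pos h]
  obtain ⟨q, hq, hqp⟩ := h.choose_spec
  exact level_unique hq hp hqp

variable (T) in
/-- A set is tree-open if it belongs to the ultrafilter of each node whose point it contains. -/
def TreeOpen (G : Set X) : Prop :=
  ∀ p, T.pt p ∈ G → G ∈ T.ultra p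

variable (T) in
/-- A coloring of the points is full if below each node, inside every tree-open set containing its
point, every color occurs. -/
def Full {K : Type*} (c : X → K) : Prop :=
  ∀ G, T.TreeOpen G → ∀ k, ∀ p ∈ T.level k, T.pt p ∈ G → ∀ a : K,
    ∃ j, ∃ q ∈ T.level j, T.pt q ∈ G ∩ T.hull p ∧ c (T.pt q) = a

theorem exists_mem_level {G : Set X} (hG : T.TreeOpen G) {k : ℕ} {p : T.Node}
    (hp : p ∈ T.level k) (hpG : T.pt p ∈ G) (i : ℕ) :
    ∃ q ∈ T.level (k + i), T.pt q ∈ G ∩ T.hull p := by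
  induction i with
  | zero => exact ⟨p, hp, hpG, T.pt_mem_hull p⟩
  | succ i ih =>
    obtain ⟨q, hq, hqG, hqp⟩ := ih
    obtain ⟨y, hyG, hy⟩ := (T.ultra q).nonempty_of_mem (inter_mem (hG q hqG) (T.succs_mem q))
    refine ⟨T.child q y, child_mem_level hq hy, by rwa [T.pt_child q y hy], ?_⟩
    have hlev := child_mem_level hq hy
    rcases Nat.eq_zero_or_pos i with rfl | hi
    · obtain rfl := eq_of_mem_hull hp hq hqp (T.pt_mem_hull q)
      exact (T.hull_child_subset p y hy (T.pt_mem_hull _)).1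
    · obtain ⟨a, ha, hqa⟩ := exists_ancestor (Nat.lt_add_of_pos_right hi) hq
      obtain rfl := eq_of_mem_hull hp ha hqp (hqa (T.pt_mem_hull q)).1
      exact (hqa (T.hull_child_subset q y hy (T.pt_mem_hull _)).1).1

theorem exists_full_of_countable (T : UltraTree X) (K : Type*) [Countable K] [Nonempty K] :
    ∃ c : X → K, T.Full c := by
  obtain ⟨e, he⟩ := exists_surjective_nat K
  refine ⟨fun x => e (Nat.unpair (T.depth x)).1, fun G hG k p hp hpG a => ?_⟩
  obtain ⟨i, rfl⟩ := he a
  obtain ⟨l, hl⟩ := Nat.exists_eq_add_of_le (Nat.right_le_pair i k)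
  obtain ⟨q, hq, hqG⟩ := exists_mem_level hG hp hpG l
  exact ⟨_, q, hq, hqG, by simp [depth_pt hq, ← hl]⟩

theorem exists_full (T : UltraTree X) {n : ℕ}
    (hT : ∀ p, ∀ m ≤ n, (T.ultra p).UnboundedAt (ℵ_ m)) (K : Type u) [Nonempty K]
    (hK : #K ≤ ℵ_ n) : ∃ c : X → K, T.Full c := by
  induction n generalizing K with
  | zero =>
    have : Countable K := by simpa [← mk_le_aleph0_iff] using hK
    exact T.exists_full_of_countable K
  | succ n ih =>
    choose f hf using fun p => hT p (n + 1) le_rfl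
    have := (isRegular_aleph_natCast.{u} n).nonempty_toType
    rw [← mk_ord_toType (ℵ_ ((n + 1 : ℕ) : Ordinal.{u}))] at hK
    obtain ⟨j⟩ := hK
    have hg : ∀ a, ∃ g : (ℵ_ (n : Ordinal.{u})).ord.ToType → K, ∀ b, j b < a → ∃ i, g i = b := by
      intro a
      have hcard : #(j ⁻¹' Iio a) ≤ #(ℵ_ (n : Ordinal.{u})).ord.ToType := by
        rw [mk_ord_toType, ← Order.lt_succ_iff, succ_aleph]
        refine (mk_preimage_of_injective _ _ j.injective).trans_lt ?_
        simpa using mk_Iio_toType_lt a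
      obtain ⟨h⟩ := hcard
      rcases isEmpty_or_nonempty (j ⁻¹' Iio a) with he | _
      · exact ⟨fun _ => Classical.arbitrary K, fun b hb => (he.false ⟨b, hb⟩).elim⟩
      · refine ⟨fun i => (Function.invFun h i : j ⁻¹' Iio a), fun b hb => ⟨h ⟨b, hb⟩, ?_⟩⟩
        exact congrArg Subtype.val (Function.leftInverse_invFun h.injective ⟨b, hb⟩)
    choose g hg using hg
    obtain ⟨c, hc⟩ := ih (fun p m hm => hT p m (hm.trans n.le_succ)) 
      ((ℵ_ (n : Ordinal.{u})).ord.ToType × ULift.{u} ℕ) (by simp)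
    refine ⟨fun x => g (f (T.ancestor (c x).2.down x)
      (T.pt (T.ancestor ((c x).2.down + 1) x))) (c x).1, ?_⟩
    intro G hG k p hp hpG b
    obtain ⟨y, ⟨hyb, hyG⟩, hy⟩ := (((hf p (j b)).and (hG p hpG)).and (T.succs_mem p)).exists
    obtain ⟨i, hi⟩ := hg (f p y) b hyb
    have hlev := child_mem_level hp hy
    obtain ⟨l, q, hq, ⟨hqG, hqy⟩, hqc⟩ := hc G hG (k + 1) (T.child p y) hlev
      (by rwa [T.pt_child p y hy]) (i, ⟨k⟩)
    have hqp := (T.hull_child_subset p y hy hqy).1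
    refine ⟨l, q, hq, ⟨hqG, hqp⟩, ?_⟩
    simp only [hqc]
    rw [ancestor_eq hp hqp, ancestor_eq hlev hqy, T.pt_child p y hy, hi]

end UltraTree

section Resolvability

variable {X : Type u} [TopologicalSpace X]

/-- The subspace `S` contains a family, indexed by `K`, of pairwise disjoint dense subsets. -/
def ResolvableOn (K : Type*) (S : Set X) : Prop :=
  ∃ A : K → Set X, Pairwise (fun a b => Disjoint (A a) (A b)) ∧
    ∀ a, A a ⊆ S ∧ S ⊆ closure (A a)

theorem ResolvableOn.comp {K L : Type*} {S : Set X} (h : ResolvableOn K S) (j : L ↪ K) :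
    ResolvableOn L S := by
  obtain ⟨A, hA, hAS⟩ := h
  exact ⟨A ∘ j, fun a b hab => hA (j.injective.ne hab), fun a => hAS (j a)⟩

theorem ResolvableOn.univ_of_forall_isOpen {K : Type*}
    (h : ∀ U : Set X, IsOpen U → U.Nonempty → ∃ S ⊆ U, S.Nonempty ∧ ResolvableOn K S) :
    ResolvableOn K (univ : Set X) := by
  obtain ⟨F, hF, hdisj, hmax⟩ := exists_maximal_pairwise
    (fun S : Set X => S.Nonempty ∧ ResolvableOn K S) Disjoint
  have hdense : Dense (⋃₀ F) := by
    rw [dense_iff_closure_eq, ← compl_empty_iff]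
    by_contra hne
    obtain ⟨S, hSU, hSne, hS⟩ := h _ isClosed_closure.isOpen_compl (nonempty_iff_ne_empty.2 hne)
    have hSd : ∀ R ∈ F, Disjoint S R := fun R hR =>
      disjoint_left.2 fun x hxS hxR => hSU hxS (subset_closure ⟨R, hR, hxR⟩)
    obtain ⟨x, hx⟩ := hSne
    exact disjoint_left.1 (hSd S (hmax S ⟨⟨x, hx⟩, hS⟩ fun R hR => ⟨hSd R hR, (hSd R hR).symm⟩))
      hx hx
  choose A hA hAS using fun S : F => (hF S S.2).2
  refine ⟨fun a => ⋃ S, A S a, fun a b hab => ?_, fun a => ⟨subset_univ _, ?_⟩⟩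
  · simp only [disjoint_iUnion_left, disjoint_iUnion_right]
    intro R S
    by_cases hSR : S = R
    · subst hSR; exact hA S hab
    · exact (hdisj S.2 R.2 (Subtype.coe_injective.ne hSR)).mono ((hAS S a).1) ((hAS R b).1)
  · rw [← hdense.closure_eq]
    refine closure_minimal (sUnion_subset fun S hS => ?_) isClosed_closure
    exact ((hAS ⟨S, hS⟩ a).2).trans (closure_mono (subset_iUnion (fun S => A S a) ⟨S, hS⟩))

theorem ResolvableOn.resolvable {K : Type u} [Nonempty X] (h : ResolvableOn K (univ : Set X)) :
    Resolvable X #K := by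
  obtain ⟨A, hA, hAd⟩ := h
  have hd : ∀ a, Dense (A a) := fun a => dense_iff_closure_eq.2 (univ_subset_iff.1 (hAd a).2)
  have hinj : Function.Injective A := by
    intro a b hab
    by_contra hne
    have : Disjoint (A a) (A b) := hA hne
    rw [hab, disjoint_self] at this
    exact (hd b).nonempty.ne_empty this
  refine ⟨range A, mk_range_eq A hinj, forall_mem_range.2 hd, ?_⟩
  rintro _ ⟨a, rfl⟩ _ ⟨b, rfl⟩ hab
  exact hA fun h => hab (congrArg A h)

/-- If each point of `S` is in the closure of small subsets of `V` disjoint from any given small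
set, then disjoint subsets of `V` accumulating at all points of `S` can be chosen greedily. -/
theorem ResolvableOn.of_small {κ : Cardinal.{u}} (hκ : κ.IsRegular) {K : Type u} (hK : #K ≤ κ)
    {S V : Set X} (hSκ : #S ≤ κ) (hSV : V ⊆ closure S)
    (h : ∀ x ∈ S, ∀ A : Set X, #A < κ → ∃ B ⊆ V, #B < κ ∧ Disjoint A B ∧ x ∈ closure B) :
    ResolvableOn K V := by
  obtain ⟨j⟩ : Nonempty (S × K ↪ κ.ord.ToType) := by
    rw [← Cardinal.le_def, mk_ord_toType, mk_prod, lift_id, lift_id]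
    exact (mul_le_mul' hSκ hK).trans (mul_eq_self hκ.aleph0_le).le
  have h' : ∀ (x : S) (A : Set X), ∃ B ⊆ V, #B < κ ∧
      (#A < κ → Disjoint A B ∧ (x : X) ∈ closure B) := by
    intro x A
    by_cases hA : #A < κ
    · obtain ⟨B, hBV, hB, hAB, hx⟩ := h x x.2 A hA
      exact ⟨B, hBV, hB, fun _ => ⟨hAB, hx⟩⟩
    · exact ⟨∅, empty_subset _, by simpa using hκ.pos, fun h => absurd h hA⟩
  choose B hBV hBκ hB using h'
  let r : S × K → S × K → Prop := fun p q => j p < j q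
  have hwf : WellFounded r := InvImage.wf j wellFounded_lt
  let step : (p : S × K) → ((q : S × K) → r q p → Set X) → Set X :=
    fun p F => B p.1 (⋃ q : {q // r q p}, F q q.2)
  let C : S × K → Set X := hwf.fix step
  have hC : ∀ p, C p = B p.1 (⋃ q : {q // r q p}, C q) := fun p => hwf.fix_eq step p
  have hCκ : ∀ p, #(C p) < κ := fun p => by rw [hC]; exact hBκ _ _
  have hUκ : ∀ p, #(⋃ q : {q // r q p}, C q : Set X) < κ := by
    intro p
    have hr : #{q // r q p} < κ :=
      (mk_preimage_of_injective j (Iio (j p)) j.injective).trans_lt (mk_Iio_toType_lt (j p))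
    exact (card_iUnion_lt_iff_forall_of_isRegular hκ hr).2 fun q => hCκ q
  have hlt : ∀ p q, r q p → Disjoint (C q) (C p) := by
    intro p q hqp
    have := (hB p.1 _ (hUκ p)).1
    rw [← hC] at this
    exact this.mono_left (subset_iUnion (fun q : {q // r q p} => C q) ⟨q, hqp⟩)
  have hdisj : ∀ p q, p ≠ q → Disjoint (C p) (C q) := by
    intro p q hpq
    rcases (j.injective.ne hpq).lt_or_gt with hlt' | hlt'
    · exact hlt q p hlt'
    · exact (hlt p q hlt').symm
  refine ⟨fun a => ⋃ x, C (x, a), fun a b hab => ?_, fun a => ⟨?_, ?_⟩⟩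
  · simp only [disjoint_iUnion_left, disjoint_iUnion_right]
    exact fun x y => hdisj _ _ fun h => hab (Prod.ext_iff.1 h).2
  · refine iUnion_subset fun x => ?_
    rw [hC]
    exact hBV _ _
  · refine hSV.trans (closure_minimal (fun x hx => ?_) isClosed_closure)
    have := (hB ⟨x, hx⟩ _ (hUκ (⟨x, hx⟩, a))).2
    rw [← hC (⟨x, hx⟩, a)] at this
    exact closure_mono (subset_iUnion (fun x => C (x, a)) ⟨x, hx⟩) this

theorem UltraTree.resolvableOn (T : UltraTree X) {n : ℕ}
    (hT : ∀ p, ∀ m ≤ n, (T.ultra p).UnboundedAt (ℵ_ m)) (hnhds : ∀ p, ↑(T.ultra p) ≤ 𝓝 (T.pt p))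
    (K : Type u) [Nonempty K] (hK : #K ≤ ℵ_ n) :
    ResolvableOn K {x | ∃ k, ∃ p ∈ T.level k, T.pt p = x} := by
  obtain ⟨c, hc⟩ := T.exists_full hT K hK
  refine ⟨fun a => {x | ∃ k, ∃ p ∈ T.level k, T.pt p = x} ∩ c ⁻¹' {a}, fun a b hab => ?_,
    fun a => ⟨inter_subset_left, ?_⟩⟩
  · refine disjoint_left.2 fun x hxa hxb => hab ?_
    exact hxa.2.symm.trans hxb.2
  · rintro _ ⟨k, p, hp, rfl⟩
    refine mem_closure_iff.2 fun G hG hpG => ?_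
    obtain ⟨j, q, hq, hqG, hqa⟩ := hc G (fun p hp => hnhds p (hG.mem_nhds hp)) k p hp hpG a
    exact ⟨T.pt q, hqG.1, ⟨j, q, hq, rfl⟩, hqa⟩

theorem MonotonicallyNormal.exists_stronglyDiscrete [T1Space X] (hmn : MonotonicallyNormal X)
    (hc : Crowded X) {W E : Set X} (hW : IsOpen W)
    (hE : ∀ O ⊆ W, IsOpen O → O.Nonempty → (O ∩ E).Nonempty) {x : X} (hx : x ∈ W) :
    ∃ (D : Set X) (N : X → Set X), D ⊆ E ∧
      (∀ y ∈ D, IsOpen (N y) ∧ y ∈ N y ∧ N y ⊆ W \ {x}) ∧ D.PairwiseDisjoint N ∧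
      x ∈ closure D := by
  obtain ⟨H, hH, hHH⟩ := hmn
  obtain ⟨s, hs, hdisj, hmax⟩ := exists_maximal_pairwise
    (fun p : X × Set X => p.1 ∈ E ∧ IsOpen p.2 ∧ p.1 ∈ p.2 ∧ p.2 ⊆ W \ {x})
    (fun p q => Disjoint (H p.1 p.2) (H q.1 q.2))
  have hch : ∀ y : X, ∃ O, y ∈ Prod.fst '' s → (y, O) ∈ s := by
    intro y
    by_cases hy : y ∈ Prod.fst '' s
    · obtain ⟨⟨y, O⟩, hp, rfl⟩ := hy
      exact ⟨O, fun _ => hp⟩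
    · exact ⟨∅, fun h => absurd h hy⟩
  choose O hO using hch
  refine ⟨Prod.fst '' s, fun y => H y (O y), ?_, ?_, ?_, ?_⟩
  · rintro _ ⟨p, hp, rfl⟩
    exact (hs p hp).1
  · intro y hy
    obtain ⟨-, ho, hyO, hsub⟩ := hs _ (hO y hy)
    obtain ⟨h1, h2, h3⟩ := hH y (O y) ho hyO
    exact ⟨h1, h2, h3.trans hsub⟩
  · intro y hy z hz hyz
    exact hdisj (hO y hy) (hO z hz) fun h => hyz (congrArg Prod.fst h)
  · rw [mem_closure_iff]
    by_contra! hcon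
    obtain ⟨G, hG, hxG, hGs⟩ := hcon
    have hGW : IsOpen (G ∩ W) := hG.inter hW
    obtain ⟨h1, h2, h3⟩ := hH x (G ∩ W) hGW ⟨hxG, hx⟩
    have hopen : IsOpen (H x (G ∩ W) \ {x}) := h1.sdiff isClosed_singleton
    have hne : (H x (G ∩ W) \ {x}).Nonempty := by
      have : (𝓝[{x}ᶜ] x).NeBot := hc x
      exact Filter.nonempty_of_mem (f := 𝓝[{x}ᶜ] x)
        (inter_mem (mem_nhdsWithin_of_mem_nhds (h1.mem_nhds h2)) self_mem_nhdsWithin)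
    obtain ⟨z, hz, hzE⟩ := hE _ (sdiff_subset.trans (h3.trans inter_subset_right)) hopen hne
    have hfar : ∀ q ∈ s, Disjoint (H z (H x (G ∩ W) \ {x})) (H q.1 q.2) := by
      intro q hq
      obtain ⟨-, hqo, hqq, hqsub⟩ := hs q hq
      refine Disjoint.mono_left ((hH z _ hopen hz).2.2.trans sdiff_subset) ?_
      rw [Set.disjoint_iff_inter_eq_empty]
      by_contra hne'
      rcases hHH x (G ∩ W) q.1 q.2 hGW ⟨hxG, hx⟩ hqo hqq (nonempty_iff_ne_empty.2 hne') with h | h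
      · exact (hqsub h).2 rfl
      · have : q.1 ∈ G ∩ Prod.fst '' s := ⟨h.1, q, hq, rfl⟩
        rw [hGs] at this
        exact this
    have hzs := hmax (z, H x (G ∩ W) \ {x})
      ⟨hzE, hopen, hz, fun w hw => ⟨(h3 hw.1).2, hw.2⟩⟩ fun q hq => ⟨hfar q hq, (hfar q hq).symm⟩
    have : z ∈ G ∩ Prod.fst '' s := ⟨(h3 hz.1).1, _, hzs, rfl⟩
    rw [hGs] at this
    exact this

theorem MonotonicallyNormal.exists_resolvableOn [T1Space X] (hmn : MonotonicallyNormal X)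
    (hc : Crowded X) {n : ℕ} {V : Set X} (hV : IsOpen V) (hVne : V.Nonempty)
    (hVn : ∀ O ⊆ V, IsOpen O → O.Nonempty → #O = ℵ_ n) (K : Type u) [Nonempty K]
    (hK : #K ≤ ℵ_ n) : ∃ S ⊆ V, S.Nonempty ∧ ResolvableOn K S := by
  have hreg := isRegular_aleph_natCast.{u} n
  set S : Set X := {x ∈ V | ∀ A : Set X, #A < ℵ_ n →
    ∃ B ⊆ V, #B < ℵ_ n ∧ Disjoint A B ∧ x ∈ closure B}
  by_cases hSV : V ⊆ closure S
  · refine ⟨V, Subset.rfl, hVne, .of_small hreg hK (S := S) ?_ hSV fun x hx => hx.2⟩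
    exact (mk_le_mk_of_subset (sep_subset _ _)).trans (hVn V Subset.rfl hV hVne).le
  obtain ⟨x₀, hx₀V, hx₀S⟩ := not_subset.1 hSV
  set V' := V \ closure S
  have hV'o : IsOpen V' := hV.sdiff isClosed_closure
  have hV'S : ∀ x ∈ V', ∃ A : Set X, #A < ℵ_ n ∧
      ∀ B ⊆ V, #B < ℵ_ n → Disjoint A B → x ∉ closure B := by
    intro x hx
    by_contra! hcon
    exact hx.2 (subset_closure ⟨hx.1, hcon⟩)
  have hstep : ∀ p : {p : X × Set X // IsOpen p.2 ∧ p.1 ∈ p.2 ∧ p.2 ⊆ V'},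
      ∃ (D : Set X) (N : X → Set X) (v : Ultrafilter X),
        (∀ y ∈ D, IsOpen (N y) ∧ y ∈ N y ∧ N y ⊆ p.1.2 \ {p.1.1}) ∧ D.PairwiseDisjoint N ∧
        ↑v ≤ 𝓝 p.1.1 ∧ D ∈ v ∧ ∀ B : Set X, #B < ℵ_ n → Bᶜ ∈ v := by
    rintro ⟨⟨x, W⟩, hW, hxW, hWV⟩
    obtain ⟨A, hA, hAx⟩ := hV'S x (hWV hxW)
    obtain ⟨D, N, hDA, hN, hdisj, hxD⟩ := hmn.exists_stronglyDiscrete hc (E := Aᶜ) hW (by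
      intro O hO hOo hOne
      by_contra hemp
      have hOA : O ⊆ A := fun y hy => by_contra fun hyA => hemp ⟨y, hy, hyA⟩
      exact (mk_le_mk_of_subset hOA).not_gt
        (hA.trans_eq (hVn O (hO.trans (hWV.trans sdiff_subset)) hOo hOne).symm)) hxW
    have hDV : D ⊆ V := fun y hy =>
      (hWV ((hN y hy).2.2 (hN y hy).2.1).1).1
    let 𝓕 : Filter X := 𝓝 x ⊓ 𝓟 D ⊓ Filter.cocardinal X hreg
    have hne : 𝓕.NeBot := by
      rw [Filter.inf_neBot_iff]
      intro s hs t ht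
      rw [Filter.mem_cocardinal] at ht
      have hB : x ∉ closure (D ∩ tᶜ) := hAx _ (inter_subset_left.trans hDV)
        ((mk_le_mk_of_subset inter_subset_right).trans_lt ht)
        (disjoint_left.2 fun y hyA hyD => hDA hyD.1 hyA)
      have hmem : (closure (D ∩ tᶜ))ᶜ ∈ 𝓝 x := isClosed_closure.isOpen_compl.mem_nhds hB
      have : (𝓝 x ⊓ 𝓟 D).NeBot := mem_closure_iff_clusterPt.1 hxD
      obtain ⟨y, ⟨hys, hyc⟩, hyD⟩ := Filter.nonempty_of_mem (inter_mem (inter_mem hs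
        (mem_inf_of_left hmem)) (mem_inf_of_right (mem_principal_self D)))
      exact ⟨y, hys, by_contra fun hyt => hyc (subset_closure ⟨hyD, hyt⟩)⟩
    have hle := Ultrafilter.of_le 𝓕
    refine ⟨D, N, Ultrafilter.of 𝓕, hN, hdisj, hle.trans (inf_le_left.trans inf_le_left), ?_, ?_⟩
    · exact hle (mem_inf_of_left (mem_inf_of_right (mem_principal_self D)))
    · intro B hB
      refine hle (mem_inf_of_right ?_)
      rwa [Filter.mem_cocardinal, compl_compl]
  choose D N v hN hdisj hv hDv hvn using hstep
  classical
  let T : UltraTree X :=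
    { Node := {p : X × Set X // IsOpen p.2 ∧ p.1 ∈ p.2 ∧ p.2 ⊆ V'}
      pt := fun p => p.1.1
      hull := fun p => p.1.2
      succs := D
      child := fun p y => if hy : y ∈ D p then
        ⟨(y, N p y), (hN p y hy).1, (hN p y hy).2.1,
          (hN p y hy).2.2.trans (sdiff_subset.trans p.2.2.2)⟩ else p
      ultra := v
      root := ⟨(x₀, V'), hV'o, ⟨hx₀V, hx₀S⟩, Subset.rfl⟩
      pt_mem_hull := fun p => p.2.2.1
      pt_child := fun p y hy => by simp [hy]
      hull_child_subset := fun p y hy => by simpa only [hy, dif_pos] using (hN p y hy).2.2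
      pairwiseDisjoint_hull := fun p y hy z hz hyz => by
        simpa only [Function.onFun, hy, hz, dif_pos] using hdisj p hy hz hyz
      succs_mem := hDv }
  refine ⟨{x | ∃ k, ∃ p ∈ T.level k, T.pt p = x}, ?_, ⟨x₀, 0, T.root, rfl, rfl⟩,
    T.resolvableOn (n := n) ?_ hv K hK⟩
  · rintro _ ⟨k, p, hp, rfl⟩
    exact (p.2.2.2 p.2.2.1).1
  · intro p m hm
    refine Ultrafilter.UnboundedAt.aleph (n := n) ?_ hm
    exact Ultrafilter.unboundedAt_of_mk_le hreg (hv p (hV.mem_nhds (p.2.2.2 p.2.2.1).1))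
      (hVn V Subset.rfl hV hVne).le (hvn p)

end Resolvability

/-- Every crowded monotonically normal space of cardinality less than ℵ_ω is
maximally resolvable. -/
theorem maximallyResolvable_of_monotonicallyNormal_card_lt_aleph_omega
    (X : Type*) [TopologicalSpace X] [T1Space X]
    (hmn : MonotonicallyNormal X) (hc : Crowded X)
    (hcard : #X < Cardinal.aleph Ordinal.omega0) : MaximallyResolvable X := by
  rcases isEmpty_or_nonempty X with hX | hX
  · have hD : Delta X = 0 := by
      have : {c : Cardinal | ∃ U : Set X, IsOpen U ∧ U.Nonempty ∧ #U = c} = ∅ := by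
        ext c
        simp [Set.eq_empty_of_isEmpty]
      rw [Delta, this, Cardinal.sInf_empty]
    exact ⟨∅, by simp [hD], by simp, by simp⟩
  have hΔ : ∀ U : Set X, IsOpen U → U.Nonempty → Delta X ≤ #U := fun U hU hne =>
    csInf_le' ⟨U, hU, hne, rfl⟩
  rw [MaximallyResolvable, ← mk_out (Delta X)]
  refine (ResolvableOn.univ_of_forall_isOpen fun U hU hUne => ?_).resolvable
  obtain ⟨V, ⟨hVU, hV, hVne⟩, hmin⟩ : ∃ V ∈ {V : Set X | V ⊆ U ∧ IsOpen V ∧ V.Nonempty},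
      ∀ O ∈ {V : Set X | V ⊆ U ∧ IsOpen V ∧ V.Nonempty}, #V ≤ #O := by
    obtain ⟨V, hV, hVm⟩ := (InvImage.wf (fun V : Set X => #V) Cardinal.lt_wf).has_min
      {V : Set X | V ⊆ U ∧ IsOpen V ∧ V.Nonempty} ⟨U, Subset.rfl, hU, hUne⟩
    exact ⟨V, hV, fun O hO => not_lt.1 (hVm O hO)⟩
  have hVinf : ℵ₀ ≤ #V := by
    rw [Cardinal.aleph0_le_mk_iff, infinite_coe_iff]
    obtain ⟨x, hx⟩ := hVne
    have := hc x
    exact infinite_of_mem_nhds x (hV.mem_nhds hx)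
  obtain ⟨n, hn⟩ : ∃ n : ℕ, #V = ℵ_ n := by
    obtain ⟨o, ho⟩ := mem_range_aleph_iff.2 hVinf
    have hlt : ℵ_ o < ℵ_ Ordinal.omega0 := ho.trans_lt ((mk_set_le V).trans_lt hcard)
    obtain ⟨n, rfl⟩ := Ordinal.lt_omega0.1 (aleph_lt_aleph.1 hlt)
    exact ⟨n, ho.symm⟩
  have hVn : ∀ O ⊆ V, IsOpen O → O.Nonempty → #O = ℵ_ n := fun O hO hOo hOne =>
    hn ▸ (mk_le_mk_of_subset hO).antisymm (hmin O ⟨hO.trans hVU, hOo, hOne⟩)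
  have := hVne.to_subtype
  obtain ⟨S, hSV, hSne, hS⟩ := hmn.exists_resolvableOn hc hV hVne hVn V hn.le
  obtain ⟨j⟩ : Nonempty ((Delta X).out ↪ V) := by
    rw [← Cardinal.le_def, mk_out]
    exact hΔ V hV hVne
  exact ⟨S, hSV.trans hVU, hSne, hS.comp j⟩
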